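/- Let M be a MAG over V = {X, Y} ∪ O satisfying the pretreatment setup. There exist a vertex S ∈ MB(X) \ {Y} and a set Z ⊆ MB(Y) \ {X} such that S and Y are m-connected given Z and S and Y are m-separated by Z ∪ {X} (rule R1 applies) if and only if M contains a visible directed edge X → Y and some subset of O satisfies the generalized adjustment criterion relative to (X, Y). (Soundness and completeness of rule R1, combining Theorems 2, 4 and 5.) -/

import Mathlib

namespace CausalGraph

/-- A directed mixed graph: directed edges `dir a b` (a → b) and bidirected
edges `bidir a b` (a ↔ b), with at most one edge between any two vertices
and no self-loops. -/
structure MixedGraph (V : Type*) where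
  dir : V → V → Prop
  bidir : V → V → Prop
  bidir_symm : ∀ a b, bidir a b → bidir b a
  dir_irrefl : ∀ a, ¬ dir a a
  bidir_irrefl : ∀ a, ¬ bidir a a
  dir_not_dir : ∀ a b, dir a b → ¬ dir b a
  dir_not_bidir : ∀ a b, dir a b → ¬ bidir a b

variable {V : Type*}

/-- Two vertices are adjacent if there is an edge (of any kind) between them. -/
def MixedGraph.adj (G : MixedGraph V) (a b : V) : Prop :=
  G.dir a b ∨ G.dir b a ∨ G.bidir a b

/-- There is an edge between `a` and `b` with an arrowhead at `b`. -/
def ArrowInto (G : MixedGraph V) (a b : V) : Prop :=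
  G.dir a b ∨ G.bidir a b

/-- `p` is a path between `a` and `b`: a list of distinct vertices, each
consecutive pair adjacent, starting at `a` and ending at `b`. -/
def IsPathBetween (G : MixedGraph V) (p : List V) (a b : V) : Prop :=
  List.Chain' G.adj p ∧ p.Nodup ∧ p.head? = some a ∧ p.getLast? = some b ∧ 2 ≤ p.length

/-- `p` is a directed path from `a` to `b`: all edges are directed edges
pointing toward `b`. -/
def IsDirectedPath (G : MixedGraph V) (p : List V) (a b : V) : Prop :=
  List.Chain' G.dir p ∧ p.Nodup ∧ p.head? = some a ∧ p.getLast? = some b ∧ 2 ≤ p.length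

/-- `a` is an ancestor of `b` (and `b` a descendant of `a`): `a = b` or there
is a directed path from `a` to `b`. -/
def Ancestor (G : MixedGraph V) (a b : V) : Prop :=
  a = b ∨ ∃ p, IsDirectedPath G p a b

/-- `w` is an intermediate (non-endpoint) vertex of the path `p`. -/
def IsIntermediateOn (p : List V) (w : V) : Prop :=
  ∃ (u v : V) (l₁ l₂ : List V), p = l₁ ++ u :: w :: v :: l₂

/-- `w` is a collider on the path `p`: both edges of the path at `w` have an
arrowhead at `w`. -/
def IsColliderOn (G : MixedGraph V) (p : List V) (w : V) : Prop :=
  ∃ (u v : V) (l₁ l₂ : List V), p = l₁ ++ u :: w :: v :: l₂ ∧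
    ArrowInto G u w ∧ ArrowInto G v w

/-- `w` is a non-collider intermediate vertex on the path `p`. -/
def IsNonColliderOn (G : MixedGraph V) (p : List V) (w : V) : Prop :=
  IsIntermediateOn p w ∧ ¬ IsColliderOn G p w

/-- The path `p` between `a` and `b` (with `a, b ∉ Z`) is m-connecting given
`Z`: every non-collider on it is not in `Z`, and every collider on it has a
descendant in `Z`. -/
def MConnPath (G : MixedGraph V) (Z : Set V) (p : List V) (a b : V) : Prop :=
  IsPathBetween G p a b ∧ a ∉ Z ∧ b ∉ Z ∧
    (∀ w, IsNonColliderOn G p w → w ∉ Z) ∧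
    (∀ w, IsColliderOn G p w → ∃ d ∈ Z, Ancestor G w d)

/-- `a` and `b` are m-separated by `Z`: no path between them is m-connecting
given `Z`. -/
def MSep (G : MixedGraph V) (Z : Set V) (a b : V) : Prop :=
  ∀ p, ¬ MConnPath G Z p a b

/-- `a` and `b` are m-connected given `Z`. -/
def MConn (G : MixedGraph V) (Z : Set V) (a b : V) : Prop :=
  ∃ p, MConnPath G Z p a b

/-- Set version of m-separation: every vertex of `A` is m-separated from every
vertex of `B` by `Z`. -/
def MSepSets (G : MixedGraph V) (Z A B : Set V) : Prop :=
  ∀ a ∈ A, ∀ b ∈ B, MSep G Z a b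

/-- `G` is a maximal ancestral graph (MAG): it is ancestral (no directed or
almost directed cycles), and every pair of distinct non-adjacent vertices is
m-separated by some set of vertices. -/
def IsMAG (G : MixedGraph V) : Prop :=
  (∀ a b, G.dir a b → ¬ Ancestor G b a) ∧
  (∀ a b, G.bidir a b → ¬ Ancestor G a b) ∧
  (∀ a b, a ≠ b → ¬ G.adj a b → ∃ Z : Set V, a ∉ Z ∧ b ∉ Z ∧ MSep G Z a b)

/-- `p` is a collider path between `a` and `b`: every intermediate vertex is a
collider on it. -/
def IsColliderPathBetween (G : MixedGraph V) (p : List V) (a b : V) : Prop :=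
  IsPathBetween G p a b ∧ ∀ w, IsIntermediateOn p w → IsColliderOn G p w

/-- The Markov blanket of `y`: all vertices adjacent to `y`, together with all
vertices non-adjacent to `y` joined to `y` by a collider path. -/
def MarkovBlanket (G : MixedGraph V) (y : V) : Set V :=
  {v | v ≠ y ∧ (G.adj v y ∨ (¬ G.adj v y ∧ ∃ p, IsColliderPathBetween G p v y))}

/-- The directed edge `x → y` is visible: there is a vertex `s` not adjacent
to `y` such that either there is an edge between `s` and `x` with an arrowhead
at `x`, or there is a collider path from `s` to `x` with an arrowhead at `x`
all of whose intermediate vertices are parents of `y`. -/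
def VisibleEdge (G : MixedGraph V) (x y : V) : Prop :=
  G.dir x y ∧ ∃ s, s ≠ y ∧ ¬ G.adj s y ∧
    (ArrowInto G s x ∨
      ∃ p, IsColliderPathBetween G p s x ∧
        (∃ (l : List V) (u : V), p = l ++ [u, x] ∧ ArrowInto G u x) ∧
        (∀ w, IsIntermediateOn p w → G.dir w y))

/-- A non-causal path from `x` to `y`: a path between `x` and `y` that is not
a directed path from `x` to `y`. -/
def NonCausalPath (G : MixedGraph V) (p : List V) (a b : V) : Prop :=
  IsPathBetween G p a b ∧ ¬ IsDirectedPath G p a b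

/-- `Z` blocks every non-causal path from `x` to `y`. -/
def BlocksAllNonCausal (G : MixedGraph V) (x y : V) (Z : Set V) : Prop :=
  ∀ p, NonCausalPath G p x y → ¬ MConnPath G Z p x y

/-- `Z` satisfies the generalized adjustment criterion relative to `(x, y)`:
every directed path from `x` to `y` starts with a visible directed edge out of
`x`, `Z` contains no descendant of any vertex lying on a directed path from
`x` to `y`, and `Z` blocks every non-causal path from `x` to `y`. -/
def ValidAdjustment (G : MixedGraph V) (x y : V) (Z : Set V) : Prop :=
  (∀ (p : List V) (w : V) (l : List V),
      IsDirectedPath G p x y → p = x :: w :: l → VisibleEdge G x w) ∧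
  (∀ v ∈ Z, ¬ ∃ (w : V) (p : List V), IsDirectedPath G p x y ∧ w ∈ p ∧ Ancestor G w v) ∧
  BlocksAllNonCausal G x y Z

/-- Pretreatment setup: `G` is a MAG over `V = {x, y} ∪ O`, `x ≠ y`, `y` is
not an ancestor of `x`, and neither `x` nor `y` is an ancestor of any vertex
of `O`. -/
structure Pretreatment (G : MixedGraph V) (x y : V) (O : Set V) : Prop where
  mag : IsMAG G
  ne : x ≠ y
  x_not_mem : x ∉ O
  y_not_mem : y ∉ O
  cover : (Set.univ : Set V) = {x, y} ∪ O
  y_not_anc_x : ¬ Ancestor G y x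
  x_not_anc_O : ∀ v ∈ O, ¬ Ancestor G x v
  y_not_anc_O : ∀ v ∈ O, ¬ Ancestor G y v

def Act (G : MixedGraph V) (Z : Set V) (u w v : V) : Prop :=
  (ArrowInto G u w ∧ ArrowInto G v w → ∃ d ∈ Z, Ancestor G w d) ∧
  (¬ (ArrowInto G u w ∧ ArrowInto G v w) → w ∉ Z)

def OpenW (G : MixedGraph V) (Z : Set V) (p : List V) : Prop :=
  p.IsChain G.adj ∧ ∀ u w v, [u, w, v] <:+: p → Act G Z u w v

lemma adj_symm {G : MixedGraph V} {a b : V} (h : G.adj a b) : G.adj b a := by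
  rcases h with h | h | h
  · exact Or.inr (Or.inl h)
  · exact Or.inl h
  · exact Or.inr (Or.inr (G.bidir_symm _ _ h))

lemma adj_ne {G : MixedGraph V} {a b : V} (h : G.adj a b) : a ≠ b := by
  rintro rfl
  rcases h with h | h | h
  · exact G.dir_irrefl _ h
  · exact G.dir_irrefl _ h
  · exact G.bidir_irrefl _ h

lemma not_arrow_iff {G : MixedGraph V} {a b : V} (h : G.adj a b) :
    ¬ ArrowInto G a b ↔ G.dir b a := by
  unfold ArrowInto
  constructor
  · intro h'
    rcases h with h | h | h
    · exact absurd (Or.inl h) h'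
    · exact h
    · exact absurd (Or.inr h) h'
  · rintro h1 (h2 | h2)
    · exact G.dir_not_dir _ _ h1 h2
    · exact G.dir_not_bidir _ _ h1 (G.bidir_symm _ _ h2)

lemma Act.symm {G : MixedGraph V} {Z : Set V} {u w v : V} (h : Act G Z u w v) :
    Act G Z v w u :=
  ⟨fun h' => h.1 h'.symm, fun h' => h.2 (fun h'' => h' h''.symm)⟩

lemma infix3_iff {p : List V} {u w v : V} :
    [u, w, v] <:+: p ↔ ∃ l₁ l₂, p = l₁ ++ u :: w :: v :: l₂ := by
  constructor
  · rintro ⟨s, t, rfl⟩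
    exact ⟨s, t, by simp⟩
  · rintro ⟨s, t, rfl⟩
    exact ⟨s, t, by simp⟩

lemma infix3_aux {r : List V} {u w v : V} (h : [u, w, v] <:+: w :: r) : w ∈ r := by
  rcases List.infix_cons_iff.1 h with h | h
  · obtain ⟨t, ht⟩ := h
    simp at ht
    rw [← ht.2]; simp
  · exact h.subset (by simp)

lemma infix3_unique {p : List V} (hp : p.Nodup) {u w v u' v' : V}
    (h : [u, w, v] <:+: p) (h' : [u', w, v'] <:+: p) : u = u' ∧ v = v' := by
  induction p with
  | nil => simp at h
  | cons a p ih =>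
    have hp' := List.nodup_cons.1 hp
    rcases List.infix_cons_iff.1 h with h1 | h1 <;> rcases List.infix_cons_iff.1 h' with h2 | h2
    · obtain ⟨t, ht⟩ := h1
      obtain ⟨t', ht'⟩ := h2
      rw [← ht'] at ht
      simp at ht
      exact ⟨ht.1, ht.2.1⟩
    · obtain ⟨t, ht⟩ := h1
      simp at ht
      rw [← ht.2] at h2 hp'
      exact absurd (infix3_aux h2) (List.nodup_cons.1 hp'.2).1
    · obtain ⟨t, ht⟩ := h2
      simp at ht
      rw [← ht.2] at h1 hp'
      exact absurd (infix3_aux h1) (List.nodup_cons.1 hp'.2).1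
    · exact ih hp'.2 h1 h2

lemma isInter_iff {p : List V} {w : V} :
    IsIntermediateOn p w ↔ ∃ u v, [u, w, v] <:+: p := by
  simp only [infix3_iff]; rfl

lemma isColl_iff {G : MixedGraph V} {p : List V} {w : V} :
    IsColliderOn G p w ↔ ∃ u v, [u, w, v] <:+: p ∧ ArrowInto G u w ∧ ArrowInto G v w := by
  simp only [infix3_iff]
  constructor
  · rintro ⟨u, v, l₁, l₂, h, h'⟩
    exact ⟨u, v, ⟨l₁, l₂, h⟩, h'⟩
  · rintro ⟨u, v, ⟨l₁, l₂, h⟩, h'⟩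
    exact ⟨u, v, l₁, l₂, h, h'⟩

lemma mconn_iff {G : MixedGraph V} {Z : Set V} {p : List V} {a b : V} :
    MConnPath G Z p a b ↔ IsPathBetween G p a b ∧ a ∉ Z ∧ b ∉ Z ∧ OpenW G Z p := by
  constructor
  · rintro ⟨h1, h2, h3, h4, h5⟩
    refine ⟨h1, h2, h3, h1.1, fun u w v ht => ⟨fun hc => ?_, fun hc => ?_⟩⟩
    · exact h5 w (isColl_iff.2 ⟨u, v, ht, hc⟩)
    · refine h4 w ⟨isInter_iff.2 ⟨u, v, ht⟩, fun hcol => hc ?_⟩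
      obtain ⟨u', v', ht', hc'⟩ := isColl_iff.1 hcol
      obtain ⟨rfl, rfl⟩ := infix3_unique h1.2.1 ht ht'
      exact hc'
  · rintro ⟨h1, h2, h3, h4, h5⟩
    refine ⟨h1, h2, h3, ?_, ?_⟩
    · rintro w ⟨hi, hc⟩
      obtain ⟨u, v, ht⟩ := isInter_iff.1 hi
      exact (h5 u w v ht).2 (fun h => hc (isColl_iff.2 ⟨u, v, ht, h⟩))
    · intro w hc
      obtain ⟨u, v, ht, h⟩ := isColl_iff.1 hc
      exact (h5 u w v ht).1 h

lemma collPath_iff {G : MixedGraph V} {p : List V} {a b : V} :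
    IsColliderPathBetween G p a b ↔ IsPathBetween G p a b ∧
      ∀ u w v, [u, w, v] <:+: p → ArrowInto G u w ∧ ArrowInto G v w := by
  constructor
  · rintro ⟨h1, h2⟩
    refine ⟨h1, fun u w v ht => ?_⟩
    obtain ⟨u', v', ht', hc'⟩ := isColl_iff.1 (h2 w (isInter_iff.2 ⟨u, v, ht⟩))
    obtain ⟨rfl, rfl⟩ := infix3_unique h1.2.1 ht ht'
    exact hc'
  · rintro ⟨h1, h2⟩
    refine ⟨h1, fun w hw => ?_⟩
    obtain ⟨u, v, ht⟩ := isInter_iff.1 hw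
    exact isColl_iff.2 ⟨u, v, ht, h2 u w v ht⟩

lemma path_ne {G : MixedGraph V} {p : List V} {a b : V} (h : IsPathBetween G p a b) : a ≠ b := by
  obtain ⟨-, h2, h3, h4, h5⟩ := h
  match p with
  | [] => simp at h5
  | [c] => simp at h5
  | c :: d :: l =>
    rintro rfl
    simp only [List.head?_cons, Option.some.injEq] at h3
    subst h3
    rw [List.getLast?_cons_cons] at h4
    exact (List.nodup_cons.1 h2).1 (List.mem_of_getLast? h4)


lemma Ancestor.refl {G : MixedGraph V} (a : V) : Ancestor G a a := Or.inl rfl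

lemma Ancestor.head {G : MixedGraph V} {a c b : V} (h : G.dir a c) (h' : Ancestor G c b) :
    Ancestor G a b := by
  by_cases hab : a = b
  · exact Or.inl hab
  right
  rcases h' with rfl | ⟨p, h1, h2, h3, h4, h5⟩
  · exact ⟨[a, c], List.IsChain.cons_cons h (List.IsChain.singleton _), by simp [hab], rfl, rfl, by simp⟩
  · by_cases hap : a ∈ p
    · obtain ⟨s, t, rfl⟩ := List.append_of_mem hap
      refine ⟨a :: t, (List.isChain_append.1 h1).2.1, (List.nodup_append.1 h2).2.1, rfl, ?_, ?_⟩
      · rw [← h4]; simp [List.getLast?_append, List.getLast?_cons]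
      · cases t with
        | nil => simp at h4; exact absurd h4 hab
        | cons d t => simp
    · cases p with
      | nil => simp at h5
      | cons d p =>
        simp only [List.head?_cons, Option.some.injEq] at h3
        subst h3
        refine ⟨a :: d :: p, ?_, List.nodup_cons.2 ⟨hap, h2⟩, rfl, ?_, by simp⟩
        · exact List.IsChain.cons_cons h h1
        · rw [List.getLast?_cons_cons]; exact h4

lemma anc_of_chain {G : MixedGraph V} {l : List V} {a b : V}
    (h : (a :: l).IsChain G.dir) (hb : (a :: l).getLast? = some b) : Ancestor G a b := by
  induction l generalizing a with
  | nil => simp at hb; exact Or.inl hb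
  | cons c l ih =>
    rw [List.isChain_cons_cons] at h
    rw [List.getLast?_cons_cons] at hb
    exact Ancestor.head h.1 (ih h.2 hb)

lemma anc_iff {G : MixedGraph V} {a b : V} :
    Ancestor G a b ↔ Relation.ReflTransGen G.dir a b := by
  constructor
  · rintro (rfl | ⟨p, h1, -, h3, h4, h5⟩)
    · exact .refl
    · cases p with
      | nil => simp at h5
      | cons c p =>
        simp only [List.head?_cons, Option.some.injEq] at h3
        subst h3
        clear h5
        induction p generalizing c with
        | nil => simp at h4; rw [h4]
        | cons d p ih =>
          have h1' := List.isChain_cons_cons.1 h1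
          rw [List.getLast?_cons_cons] at h4
          exact .head h1'.1 (ih d h1'.2 h4)
  · intro h
    induction h using Relation.ReflTransGen.head_induction_on with
    | refl => exact Or.inl rfl
    | head h _ ih => exact Ancestor.head h ih

lemma Ancestor.trans {G : MixedGraph V} {a c b : V} (h : Ancestor G a c) (h' : Ancestor G c b) :
    Ancestor G a b := by
  rw [anc_iff] at *; exact h.trans h'


lemma forward_aux {G : MixedGraph V} {A : Set V} (hA : ∀ a b, G.dir a b → b ∈ A → a ∈ A)
    {u w : V} {l : List V} (hc : (u :: w :: l).IsChain G.adj)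
    (ht : ∀ a b c, [a, b, c] <:+: u :: w :: l → ArrowInto G a b → ArrowInto G c b → b ∈ A)
    (h : G.dir u w) : u ∈ A ∨ (u :: w :: l).IsChain G.dir := by
  induction l generalizing u w with
  | nil => right; simp [h]
  | cons v l ih =>
    by_cases hv : ArrowInto G v w
    · left
      exact hA _ _ h (ht u w v (infix3_iff.2 ⟨[], l, rfl⟩) (Or.inl h) hv)
    · have hc' := List.isChain_cons_cons.1 hc
      have hc'' := List.isChain_cons_cons.1 hc'.2
      have hd : G.dir w v := (not_arrow_iff (adj_symm hc''.1)).1 hv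
      rcases ih hc'.2 (fun a b c hi => ht a b c (List.infix_cons hi)) hd with h1 | h1
      · exact Or.inl (hA _ _ h h1)
      · exact Or.inr (List.IsChain.cons_cons h h1)

lemma forward_mem {G : MixedGraph V} {A : Set V} (hA : ∀ a b, G.dir a b → b ∈ A → a ∈ A)
    {u w : V} {l : List V} (hc : (u :: w :: l).IsChain G.adj)
    (ht : ∀ a b c, [a, b, c] <:+: u :: w :: l → ArrowInto G a b → ArrowInto G c b → b ∈ A)
    (h : G.dir u w) {z : V} (hz : (u :: w :: l).getLast? = some z) (hzA : z ∈ A) : u ∈ A := by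
  rcases forward_aux hA hc ht h with h1 | h1
  · exact h1
  · have := anc_iff.1 (anc_of_chain h1 hz)
    clear hc ht h hz h1
    induction this using Relation.ReflTransGen.head_induction_on with
    | refl => exact hzA
    | head h _ ih => exact hA _ _ h ‹_›

lemma infix_reverse3 {p : List V} {u w v : V} (h : [u, w, v] <:+: p.reverse) : [v, w, u] <:+: p := by
  rw [← List.reverse_infix]; simpa using h

lemma chain_reverse {G : MixedGraph V} {p : List V} (h : p.IsChain G.adj) :
    p.reverse.IsChain G.adj := by
  rw [List.isChain_reverse]
  exact h.imp (fun _ _ h => adj_symm h)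

lemma OpenW.reverse {G : MixedGraph V} {Z : Set V} {p : List V} (h : OpenW G Z p) :
    OpenW G Z p.reverse :=
  ⟨chain_reverse h.1, fun u w v hi => (h.2 v w u (infix_reverse3 hi)).symm⟩

lemma all_mem {G : MixedGraph V} {A : Set V} (hA : ∀ a b, G.dir a b → b ∈ A → a ∈ A)
    {p : List V} (hc : p.IsChain G.adj)
    (ht : ∀ a b c, [a, b, c] <:+: p → ArrowInto G a b → ArrowInto G c b → b ∈ A)
    {a b : V} (ha : p.head? = some a) (hb : p.getLast? = some b) (haA : a ∈ A) (hbA : b ∈ A) :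
    ∀ w ∈ p, w ∈ A := by
  intro w hw
  obtain ⟨s, t, rfl⟩ := List.append_of_mem hw
  cases t with
  | nil => simp at hb; rwa [hb]
  | cons v t =>
    have hc2 := (List.isChain_append.1 hc).2.1
    have hvw := (List.isChain_cons_cons.1 hc2).1
    by_cases hv : ArrowInto G v w
    · rcases List.eq_nil_or_concat s with rfl | ⟨s, u, rfl⟩
      · simp at ha; rwa [ha]
      · have hr := chain_reverse hc
        have e : (s.concat u ++ w :: v :: t).reverse = (t.reverse ++ [v]) ++ w :: u :: s.reverse := by simp
        rw [e] at hr
        have hr2 := (List.isChain_append.1 hr).2.1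
        have hwu := (List.isChain_cons_cons.1 hr2).1
        by_cases hu : ArrowInto G u w
        · exact ht u w v (infix3_iff.2 ⟨s, t, by simp⟩) hu hv
        · refine forward_mem hA hr2 (fun a b c hi h1 h2 => ht c b a ?_ h2 h1)
            ((not_arrow_iff (adj_symm hwu)).1 hu) (z := a) ?_ haA
          · apply infix_reverse3
            rw [e]
            exact hi.trans (List.suffix_append _ _).isInfix
          · have : (s.concat u ++ w :: v :: t).reverse.getLast? = some a := by
              rw [List.getLast?_reverse]; exact ha
            rw [e] at this
            simpa [List.getLast?_append, List.getLast?_cons] using this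
    · refine forward_mem hA hc2 (fun a b c hi => ht a b c (hi.trans (List.suffix_append _ _).isInfix))
        ((not_arrow_iff (adj_symm hvw)).1 hv) (z := b) ?_ hbA
      simpa [List.getLast?_append] using hb


lemma infix3_split {l₁ l₂ : List V} {z u w c : V} (h : [u, w, c] <:+: l₁ ++ z :: l₂) :
    [u, w, c] <:+: l₁ ++ [z] ∨ [u, w, c] <:+: z :: l₂ ∨
      (w = z ∧ (∃ l, l₁ = l ++ [u]) ∧ ∃ l, l₂ = c :: l) := by
  induction l₁ with
  | nil => exact Or.inr (Or.inl h)
  | cons a l ih =>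
    rcases List.infix_cons_iff.1 h with h | h
    · obtain ⟨t, ht⟩ := h
      match l with
      | [] =>
        simp at ht
        obtain ⟨rfl, rfl, rfl⟩ := ht
        exact Or.inr (Or.inr ⟨rfl, ⟨[], rfl⟩, ⟨_, rfl⟩⟩)
      | [b] =>
        simp at ht
        obtain ⟨rfl, rfl, rfl, rfl⟩ := ht
        exact Or.inl (by simp)
      | b :: d :: l =>
        simp at ht
        obtain ⟨rfl, rfl, rfl, rfl⟩ := ht
        exact Or.inl (infix3_iff.2 ⟨[], _, rfl⟩)
    · rcases ih h with h | h | ⟨h1, ⟨l', h2⟩, h3⟩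
      · exact Or.inl (List.infix_cons h)
      · exact Or.inr (Or.inl h)
      · exact Or.inr (Or.inr ⟨h1, ⟨a :: l', by rw [h2]; rfl⟩, h3⟩)

lemma exists_dup {p : List V} (h : ¬ p.Nodup) : ∃ l₁ z m l₂, p = l₁ ++ z :: (m ++ z :: l₂) := by
  induction p with
  | nil => simp at h
  | cons a p ih =>
    by_cases ha : a ∈ p
    · obtain ⟨s, t, rfl⟩ := List.append_of_mem ha
      exact ⟨[], a, s, t, rfl⟩
    · have : ¬ p.Nodup := fun h' => h (List.nodup_cons.2 ⟨ha, h'⟩)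
      obtain ⟨l₁, z, m, l₂, rfl⟩ := ih this
      exact ⟨a :: l₁, z, m, l₂, rfl⟩

lemma openW_cut {G : MixedGraph V} {Z : Set V} {l₁ m l₂ : List V} {z : V}
    (h : OpenW G Z (l₁ ++ z :: (m ++ z :: l₂))) : OpenW G Z (l₁ ++ z :: l₂) := by
  have e1 : l₁ ++ z :: (m ++ z :: l₂) = (l₁ ++ [z]) ++ (m ++ z :: l₂) := by simp
  have e2 : l₁ ++ z :: (m ++ z :: l₂) = (l₁ ++ z :: m) ++ (z :: l₂) := by simp
  have e3 : l₁ ++ z :: (m ++ z :: l₂) = l₁ ++ (z :: m ++ [z]) ++ l₂ := by simp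
  have i1 : l₁ ++ [z] <:+: l₁ ++ z :: (m ++ z :: l₂) := by
    rw [e1]; exact (List.prefix_append _ _).isInfix
  have i2 : z :: l₂ <:+: l₁ ++ z :: (m ++ z :: l₂) := by
    rw [e2]; exact (List.suffix_append _ _).isInfix
  have i3 : z :: m ++ [z] <:+: l₁ ++ z :: (m ++ z :: l₂) := by
    rw [e3]; exact ⟨l₁, l₂, rfl⟩
  have c1 := h.1.infix i1
  have c2 := h.1.infix i2
  have c3 := h.1.infix i3
  refine ⟨List.isChain_split.2 ⟨c1, c2⟩, fun u w c hi => ?_⟩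
  rcases infix3_split hi with hi | hi | ⟨rfl, ⟨l, rfl⟩, ⟨l', rfl⟩⟩
  · exact h.2 u w c (hi.trans i1)
  · exact h.2 u w c (hi.trans i2)
  · cases m with
    | nil => simp at c3; exact absurd rfl (adj_ne c3)
    | cons m0 m =>
      obtain ⟨n, m1, hn⟩ : ∃ n m1, m0 :: m = n ++ [m1] := by
        rcases List.eq_nil_or_concat (m0 :: m) with h | ⟨n, m1, h⟩
        · simp at h
        · exact ⟨n, m1, by simpa using h⟩
      have t1 := h.2 u w m0 (infix3_iff.2 ⟨l, m ++ w :: c :: l', by simp⟩)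
      have t2 := h.2 m1 w c (infix3_iff.2 ⟨l ++ [u] ++ w :: n, l', by rw [hn]; simp⟩)
      have a1 : G.adj w m0 := by
        have := (List.isChain_cons_cons.1 (by simpa using c3 : (w :: m0 :: (m ++ [w])).IsChain G.adj)).1
        exact this
      have lastadj : ∀ R : V → V → Prop, (w :: (m0 :: m) ++ [w]).IsChain R → R m1 w := by
        intro R hR
        have : [m1, w] <:+: (w :: (m0 :: m) ++ [w]) := ⟨w :: n, [], by rw [hn]; simp⟩
        simpa using hR.infix this
      have a2 : G.adj m1 w := lastadj _ c3
      by_cases hm0 : ArrowInto G m0 w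
      · refine ⟨fun hh => t1.1 ⟨hh.1, hm0⟩, fun hh => ?_⟩
        by_cases hu : ArrowInto G u w
        · exact t2.2 (fun h' => hh ⟨hu, h'.2⟩)
        · exact t1.2 (fun h' => hu h'.1)
      by_cases hm1 : ArrowInto G m1 w
      · refine ⟨fun hh => t2.1 ⟨hm1, hh.2⟩, fun hh => ?_⟩
        by_cases hu : ArrowInto G c w
        · exact t1.2 (fun h' => hh ⟨h'.1, hu⟩)
        · exact t2.2 (fun h' => hu h'.2)
      refine ⟨fun _ => ?_, fun _ => t1.2 (fun h' => hm0 h'.2)⟩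
      have d0 : G.dir w m0 := (not_arrow_iff (adj_symm a1)).1 hm0
      have d1 : G.dir w m1 := (not_arrow_iff a2).1 hm1
      rcases forward_aux (A := {w | ∃ d ∈ Z, Ancestor G w d})
        (fun a b hab ⟨d, hd, hbd⟩ => ⟨d, hd, Ancestor.head hab hbd⟩)
        (u := w) (w := m0) (l := m ++ [w]) (by simpa using c3)
        (fun a b c hi hab hcb => (h.2 a b c (hi.trans i3)).1 ⟨hab, hcb⟩) d0 with h1 | h1
      · exact h1
      · exact absurd (lastadj _ (by simpa using h1)) (G.dir_not_dir _ _ d1)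

lemma path_of_walk {G : MixedGraph V} {Z : Set V} {a b : V} (hab : a ≠ b) (n : ℕ) :
    ∀ p : List V, p.length = n → OpenW G Z p → p.head? = some a → p.getLast? = some b →
    ∃ q, IsPathBetween G q a b ∧ OpenW G Z q := by
  induction n using Nat.strong_induction_on with
  | _ n ih =>
    intro p hn ho ha hb
    by_cases hd : p.Nodup
    · refine ⟨p, ⟨ho.1, hd, ha, hb, ?_⟩, ho⟩
      match p with
      | [] => simp at ha
      | [c] => simp at ha hb; exact absurd (ha.symm.trans hb) hab
      | c :: d :: l => simp
    · obtain ⟨l₁, z, m, l₂, rfl⟩ := exists_dup hd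
      refine ih (l₁ ++ z :: l₂).length ?_ _ rfl (openW_cut ho) ?_ ?_
      · simp at hn ⊢; omega
      · cases l₁ <;> simpa using ha
      · simpa [List.getLast?_append, List.getLast?_cons] using hb


lemma openW_cons {G : MixedGraph V} {Z : Set V} {c w u : V} {l : List V}
    (h : OpenW G Z (w :: u :: l)) (hadj : G.adj c w) (ha : Act G Z c w u) :
    OpenW G Z (c :: w :: u :: l) := by
  refine ⟨List.IsChain.cons_cons hadj h.1, fun a b d hi => ?_⟩
  rcases List.infix_cons_iff.1 hi with ⟨t, ht⟩ | hi
  · simp at ht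
    obtain ⟨rfl, rfl, rfl, -⟩ := ht
    exact ha
  · exact h.2 _ _ _ hi

lemma openW_pair {G : MixedGraph V} {Z : Set V} {a b : V} (h : G.adj a b) :
    OpenW G Z [a, b] := by
  refine ⟨List.IsChain.cons_cons h (List.IsChain.singleton _), fun u w v hi => ?_⟩
  have := hi.length_le
  simp at this

lemma act_of_dir {G : MixedGraph V} {Z : Set V} {c w u : V} (h : G.dir w c)
    (hw : ¬ ∃ d ∈ Z, Ancestor G w d) : Act G Z c w u := by
  have hn : ¬ ArrowInto G c w := (not_arrow_iff (Or.inr (Or.inl h))).2 h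
  exact ⟨fun h' => absurd h'.1 hn, fun _ hz => hw ⟨w, hz, Ancestor.refl w⟩⟩

lemma extend_to_b {G : MixedGraph V} {Z : Set V} {w b : V}
    (h : Relation.ReflTransGen G.dir w b) : ∀ u r, OpenW G Z (w :: u :: r) →
    (¬ ∃ d ∈ Z, Ancestor G w d) →
    ∃ p, OpenW G Z p ∧ p.head? = some b ∧ p.getLast? = (w :: u :: r).getLast? := by
  induction h using Relation.ReflTransGen.head_induction_on with
  | refl => exact fun u r ho _ => ⟨_, ho, rfl, rfl⟩
  | @head w c h _ ih =>
    intro u r ho hw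
    have := ih w (u :: r) (openW_cons ho (Or.inr (Or.inl h)) (act_of_dir h hw))
      (fun ⟨d, hd, hcd⟩ => hw ⟨d, hd, Ancestor.head h hcd⟩)
    simpa only [List.getLast?_cons_cons] using this

lemma restart_at_a {G : MixedGraph V} {Z : Set V} {q a : V}
    (h : Relation.ReflTransGen G.dir q a) : (¬ ∃ d ∈ Z, Ancestor G q d) →
    ∀ c, G.adj c q → ∃ r, OpenW G Z (c :: q :: r) ∧ (c :: q :: r).getLast? = some a := by
  induction h using Relation.ReflTransGen.head_induction_on with
  | refl => exact fun _ c hc => ⟨[], openW_pair hc, rfl⟩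
  | @head q d h _ ih =>
    intro hq c hc
    obtain ⟨r, hr, hl⟩ := ih (fun ⟨e, he, hde⟩ => hq ⟨e, he, Ancestor.head h hde⟩) q (Or.inl h)
    refine ⟨d :: r, openW_cons hr hc (act_of_dir h hq).symm, ?_⟩
    rw [List.getLast?_cons_cons]; exact hl

lemma inducing_aux {G : MixedGraph V} {Z : Set V} {a b : V} (l : List V) :
    ∀ u w r, OpenW G Z (w :: u :: r) → (w :: u :: r).getLast? = some a →
    (w :: l).getLast? = some b → (u :: w :: l).IsChain G.adj →
    (∀ c d e, [c, d, e] <:+: u :: w :: l → ArrowInto G c d ∧ ArrowInto G e d) →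
    (∀ v ∈ w :: l, Ancestor G v a ∨ Ancestor G v b) →
    ∃ p, OpenW G Z p ∧ p.head? = some b ∧ p.getLast? = some a := by
  induction l with
  | nil =>
    intro u w r ho ha hb _ _ _
    simp at hb
    exact ⟨_, ho, by simp [hb], ha⟩
  | cons c l ih =>
    intro u w r ho ha hb hc ht hA
    have htw := ht u w c (infix3_iff.2 ⟨[], l, rfl⟩)
    have hc' := List.isChain_cons_cons.1 hc
    have hwc : G.adj w c := (List.isChain_cons_cons.1 hc'.2).1
    rw [List.getLast?_cons_cons] at hb
    have ht' : ∀ x d e, [x, d, e] <:+: w :: c :: l → ArrowInto G x d ∧ ArrowInto G e d :=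
      fun x d e hi => ht x d e (List.infix_cons hi)
    have hA' : ∀ v ∈ c :: l, Ancestor G v a ∨ Ancestor G v b :=
      fun v hv => hA v (List.mem_cons_of_mem _ hv)
    by_cases hZ : ∃ d ∈ Z, Ancestor G w d
    · exact ih w c (u :: r)
        (openW_cons ho (adj_symm hwc) ⟨fun _ => hZ, fun h => absurd htw.symm h⟩)
        (by rw [List.getLast?_cons_cons]; exact ha) hb hc'.2 ht' hA'
    · rcases hA w (by simp) with h | h
      · obtain ⟨r', hr', hl'⟩ := restart_at_a (anc_iff.1 h) hZ c (adj_symm hwc)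
        exact ih w c r' hr' hl' hb hc'.2 ht' hA'
      · obtain ⟨p, h1, h2, h3⟩ := extend_to_b (anc_iff.1 h) u r ho hZ
        exact ⟨p, h1, h2, h3.trans ha⟩

lemma no_inducing {G : MixedGraph V} (hG : IsMAG G) {a b : V} (hadj : ¬ G.adj a b) {p : List V}
    (hp : IsColliderPathBetween G p a b) (hA : ∀ w ∈ p, Ancestor G w a ∨ Ancestor G w b) :
    False := by
  rw [collPath_iff] at hp
  obtain ⟨hp, ht⟩ := hp
  have hne := path_ne hp
  obtain ⟨Z, ha, hb, hs⟩ := hG.2.2 a b hne hadj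
  obtain ⟨h1, h2, h3, h4, h5⟩ := hp
  match p with
  | [] => simp at h5
  | [c] => simp at h5
  | c :: q :: l =>
    simp only [List.head?_cons, Option.some.injEq] at h3
    subst h3
    rw [List.getLast?_cons_cons] at h4
    have hcq := (List.isChain_cons_cons.1 h1).1
    obtain ⟨p, o1, o2, o3⟩ := inducing_aux (Z := Z) l c q [] (openW_pair (adj_symm hcq)) (by simp) h4 h1 ht
      (fun v hv => hA v (List.mem_cons_of_mem _ hv))
    obtain ⟨q', hq', ho'⟩ := path_of_walk hne _ p.reverse rfl o1.reverse (by simpa using o3)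
      (by simpa using o2)
    exact hs q' (mconn_iff.2 ⟨hq', ha, hb, ho'⟩)

def DSepSet (G : MixedGraph V) (s y : V) : Set V :=
  {v | v ≠ y ∧ ∃ p, IsColliderPathBetween G p v y ∧ ∀ w ∈ p, Ancestor G w s ∨ Ancestor G w y}

lemma dsep_sep {G : MixedGraph V} (hG : IsMAG G) {s y : V} (hadj : ¬ G.adj s y) :
    s ∉ DSepSet G s y ∧ MSep G (DSepSet G s y) s y := by
  refine ⟨fun ⟨_, p, hp, hA⟩ => no_inducing hG hadj hp hA, fun p hp => ?_⟩
  obtain ⟨hp, -, -, ho⟩ := mconn_iff.1 hp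
  have hAll : ∀ w ∈ p, w ∈ {w | Ancestor G w s ∨ Ancestor G w y} := by
    refine all_mem ?_ hp.1 ?_ hp.2.2.1 hp.2.2.2.1 (Or.inl (Ancestor.refl _))
      (Or.inr (Ancestor.refl _))
    · rintro a b hab (h | h)
      · exact Or.inl (Ancestor.head hab h)
      · exact Or.inr (Ancestor.head hab h)
    · intro a b c hi hab hcb
      obtain ⟨d, ⟨_, q, hq, hqA⟩, hbd⟩ := (ho.2 a b c hi).1 ⟨hab, hcb⟩
      rcases hqA d (List.mem_of_head? hq.1.2.2.1) with h | h
      · exact Or.inl (hbd.trans h)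
      · exact Or.inr (hbd.trans h)
  have key : ∀ l₂ l₁, p = l₁ ++ l₂ →
      ∀ u w v, [u, w, v] <:+: l₂ → ArrowInto G u w ∧ ArrowInto G v w := by
    intro l₂
    induction l₂ with
    | nil => intro l₁ _ u w v hi; simp at hi
    | cons a l ih =>
      intro l₁ e u w v hi
      have ih' := ih (l₁ ++ [a]) (by simp [e])
      have hi0 := hi
      rcases List.infix_cons_iff.1 hi with ⟨t, ht⟩ | hi
      · simp at ht
        obtain ⟨rfl, rfl⟩ := ht
        by_contra hcon
        refine (ho.2 u w v (hi0.trans ⟨l₁, [], by simp [e]⟩)).2 hcon ?_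
        have hsuf : w :: v :: t <:+ p := ⟨l₁ ++ [u], by simp [e]⟩
        have hpath : IsPathBetween G (w :: v :: t) w y := by
          refine ⟨hp.1.suffix hsuf, hp.2.1.sublist hsuf.sublist, rfl, ?_, by simp⟩
          have := hp.2.2.2.1
          rw [e] at this
          simpa [List.getLast?_append, List.getLast?_cons] using this
        exact ⟨path_ne hpath, _, collPath_iff.2 ⟨hpath, ih'⟩, fun x hx => hAll x (hsuf.subset hx)⟩
      · exact ih' u w v hi
  exact no_inducing hG hadj (collPath_iff.2 ⟨hp, key p [] rfl⟩) hAll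


lemma Pretreatment.mem_O {G : MixedGraph V} {x y : V} {O : Set V} (h : Pretreatment G x y O)
    {v : V} (hx : v ≠ x) (hy : v ≠ y) : v ∈ O := by
  have : v ∈ ({x, y} ∪ O : Set V) := h.cover ▸ Set.mem_univ v
  simpa [hx, hy] using this

lemma Pretreatment.dir_x {G : MixedGraph V} {x y : V} {O : Set V} (h : Pretreatment G x y O)
    {v : V} (hv : G.dir x v) : v = y := by
  by_contra hy
  have hx : v ≠ x := by rintro rfl; exact G.dir_irrefl _ hv
  exact h.x_not_anc_O v (h.mem_O hx hy) (Ancestor.head hv (Ancestor.refl _))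

lemma Pretreatment.not_dir_y {G : MixedGraph V} {x y : V} {O : Set V} (h : Pretreatment G x y O)
    {v : V} (hv : G.dir y v) : False := by
  have hy : v ≠ y := by rintro rfl; exact G.dir_irrefl _ hv
  by_cases hx : v = x
  · subst hx
    exact h.y_not_anc_x (Ancestor.head hv (Ancestor.refl _))
  · exact h.y_not_anc_O v (h.mem_O hx hy) (Ancestor.head hv (Ancestor.refl _))

lemma dirPath_eq {G : MixedGraph V} {x y : V} {O : Set V} (h : Pretreatment G x y O)
    {p : List V} (hp : IsDirectedPath G p x y) : p = [x, y] := by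
  obtain ⟨h1, h2, h3, h4, h5⟩ := hp
  match p with
  | [] => simp at h5
  | [c] => simp at h5
  | c :: d :: l =>
    simp only [List.head?_cons, Option.some.injEq] at h3
    subst h3
    have h1' := List.isChain_cons_cons.1 h1
    obtain rfl := h.dir_x h1'.1
    cases l with
    | nil => rfl
    | cons e l => exact (h.not_dir_y (List.isChain_cons_cons.1 h1'.2).1).elim

lemma exists_valid {G : MixedGraph V} {x y : V} {O : Set V} (h : Pretreatment G x y O)
    (hv : VisibleEdge G x y) : ∃ Z ⊆ O, ValidAdjustment G x y Z := by
  have hxy : G.dir x y := hv.1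
  refine ⟨{v | v ∈ O ∧ Ancestor G v y}, fun v hv => hv.1, ?_, ?_, ?_⟩
  · intro p w l hp e
    rw [dirPath_eq h hp] at e
    simp at e
    rw [← e.1]; exact hv
  · rintro v ⟨hvO, -⟩ ⟨w, p, hp, hw, ha⟩
    rw [dirPath_eq h hp] at hw
    simp at hw
    rcases hw with rfl | rfl
    · exact h.x_not_anc_O v hvO ha
    · exact h.y_not_anc_O v hvO ha
  · rintro p ⟨-, hnd⟩ hm
    obtain ⟨hp, -, -, ho⟩ := mconn_iff.1 hm
    have hAll : ∀ w ∈ p, w ∈ {w | Ancestor G w y} := by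
      refine all_mem (fun a b hab hb => Ancestor.head hab hb) hp.1 ?_ hp.2.2.1 hp.2.2.2.1
        (Ancestor.head hxy (Ancestor.refl _)) (Ancestor.refl _)
      intro a b c hi hab hcb
      obtain ⟨d, ⟨_, hd⟩, hbd⟩ := (ho.2 a b c hi).1 ⟨hab, hcb⟩
      exact hbd.trans hd
    obtain ⟨h1, h2, h3, h4, h5⟩ := hp
    obtain ⟨l, e⟩ := List.getLast?_eq_some_iff.1 h4
    subst e
    rcases List.eq_nil_or_concat l with rfl | ⟨l, w, rfl⟩
    · simp at h5
    rcases List.eq_nil_or_concat l with rfl | ⟨l, u, rfl⟩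
    · simp at h3
      subst h3
      exact hnd ⟨List.IsChain.cons_cons hxy (List.IsChain.singleton _), h2, rfl, rfl, h5⟩
    · have hi : [u, w, y] <:+: (l.concat u).concat w ++ [y] := ⟨l, [], by simp⟩
      have hwy : w ≠ y := by rintro rfl; simp [List.nodup_append] at h2
      have hwx : w ≠ x := by
        rintro rfl
        cases l <;> simp at h3 h2
        · simp [h3] at h2
        · simp [h3] at h2
      have hw : w ∈ O := h.mem_O hwx hwy
      have hanc : Ancestor G w y := hAll w (by simp)
      have hcol : ArrowInto G u w ∧ ArrowInto G y w := by
        by_contra hcon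
        exact (ho.2 u w y hi).2 hcon ⟨hw, hanc⟩
      rcases hcol.2 with h' | h'
      · exact h.not_dir_y h'
      · exact h.mag.2.1 w y (G.bidir_symm _ _ h') hanc

lemma visible_imp {G : MixedGraph V} {x y : V} {O : Set V} (h : Pretreatment G x y O)
    (hv : VisibleEdge G x y) :
    ∃ S ∈ MarkovBlanket G x \ {y}, ∃ Z ⊆ MarkovBlanket G y \ {x},
        MConn G Z S y ∧ MSep G (Z ∪ {x}) S y := by
  obtain ⟨hxy, s, hsy, hadj, hs⟩ := hv
  obtain ⟨p, hp, hpar⟩ : ∃ p, IsColliderPathBetween G p s x ∧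
      ∀ w, IsIntermediateOn p w → G.dir w y := by
    rcases hs with hs | ⟨p, hp, -, hw⟩
    · have hsx : G.adj s x := hs.elim Or.inl (fun h => Or.inr (Or.inr h))
      have hno : ∀ w, ¬ IsIntermediateOn [s, x] w := by
        intro w hw
        obtain ⟨u, v, hi⟩ := isInter_iff.1 hw
        have := hi.length_le
        simp at this
      exact ⟨[s, x], ⟨⟨(openW_pair (Z := ∅) hsx).1, by simp [adj_ne hsx], rfl, rfl, by simp⟩,
        fun w hw => (hno w hw).elim⟩, fun w hw => (hno w hw).elim⟩
    · exact ⟨p, hp, hw⟩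
  have hsx := path_ne hp.1
  obtain ⟨hsD, hsep⟩ := dsep_sep h.mag hadj
  have hparD : ∀ w, G.dir w y → w ∈ DSepSet G s y := by
    intro w hw
    have hne : w ≠ y := adj_ne (Or.inl hw)
    refine ⟨hne, [w, y], collPath_iff.2 ⟨⟨List.IsChain.cons_cons (Or.inl hw)
      (List.IsChain.singleton _), by simp [hne], rfl, rfl, by simp⟩, ?_⟩, ?_⟩
    · intro u w v hi
      have := hi.length_le
      simp at this
    · intro v hv
      simp at hv
      rcases hv with rfl | rfl
      · exact Or.inr (Ancestor.head hw (Ancestor.refl _))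
      · exact Or.inr (Ancestor.refl _)
  have hxD := hparD x hxy
  have hyD : y ∉ DSepSet G s y := fun h' => h'.1 rfl
  refine ⟨s, ⟨⟨hsx, ?_⟩, hsy⟩, DSepSet G s y \ {x}, ?_, ?_, ?_⟩
  · by_cases ha : G.adj s x
    · exact Or.inl ha
    · exact Or.inr ⟨ha, p, hp⟩
  · rintro v ⟨⟨hvy, q, hq, -⟩, hvx⟩
    refine ⟨⟨hvy, ?_⟩, hvx⟩
    by_cases ha : G.adj v y
    · exact Or.inl ha
    · exact Or.inr ⟨ha, q, hq⟩
  · obtain ⟨hp, ht⟩ := collPath_iff.1 hp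
    obtain ⟨h1, h2, h3, h4, h5⟩ := hp
    obtain ⟨l, rfl⟩ := List.getLast?_eq_some_iff.1 h4
    have hy : y ∉ l ++ [x] := by
      intro hmem
      obtain ⟨a, b, e⟩ := List.append_of_mem hmem
      rcases a.eq_nil_or_concat with rfl | ⟨a, c, rfl⟩
      · rw [e] at h3; simp at h3; exact hsy h3.symm
      · cases b with
        | nil =>
          rw [e] at h4; simp at h4; exact h.ne h4.symm
        | cons d b =>
          exact G.dir_irrefl y (hpar y ⟨c, d, a, b, by rw [e]; simp⟩)
    refine ⟨l ++ [x] ++ [y], mconn_iff.2 ⟨⟨?_, ?_, ?_, by simp, by simp⟩, fun h' => hsD h'.1,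
      fun h' => hyD h'.1, ?_, ?_⟩⟩
    · exact List.isChain_append.2 ⟨h1, by simp, by simp; exact Or.inl hxy⟩
    · refine List.nodup_append.2 ⟨h2, by simp, ?_⟩
      rintro a ha b hb rfl
      simp at hb
      exact hy (hb ▸ ha)
    · cases l with
      | nil => simpa using h3
      | cons c l => simpa using h3
    · exact List.isChain_append.2 ⟨h1, by simp, by simp; exact Or.inl hxy⟩
    · intro u w v hi
      rw [List.append_assoc] at hi
      rcases infix3_split (l₂ := [y]) hi with hi | hi | ⟨rfl, -, ⟨l', e⟩⟩
      · have hw := hpar w (isInter_iff.2 ⟨u, v, hi⟩)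
        refine ⟨fun _ => ⟨w, ⟨hparD w hw, ?_⟩, Ancestor.refl w⟩, fun hn => absurd (ht u w v hi) hn⟩
        rintro rfl
        have := infix3_aux (r := l.reverse) (by simpa using
          (List.reverse_infix.2 hi) : [v, w, u] <:+: w :: l.reverse)
        rw [List.nodup_append] at h2
        exact h2.2.2 w (by simpa using this) w (by simp) rfl
      · have := hi.length_le
        simp at this
      · simp at e
        obtain ⟨rfl, -⟩ := e
        have : ¬ ArrowInto G y w := (not_arrow_iff (Or.inr (Or.inl hxy))).2 hxy
        exact ⟨fun h' => absurd h'.2 this, fun _ h' => h'.2 rfl⟩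
  · have : DSepSet G s y \ {x} ∪ {x} = DSepSet G s y := by
      ext v
      by_cases hv : v = x
      · subst hv; simp [hxD]
      · simp [hv]
    rw [this]
    exact hsep


lemma r1_aux {G : MixedGraph V} {x y S : V} {O Z : Set V} (h : Pretreatment G x y O)
    (hxy : G.dir x y) (hSx : S ≠ x) {p : List V} (hp : MConnPath G Z p S y)
    (hsep : MSep G (Z ∪ {x}) S y) (L : List V) :
    ∀ u c r, p = L ++ (u :: c :: r) ++ [y] → (∀ w ∈ c :: r, G.dir w y) →
      (c :: r).getLast? = some x → ArrowInto G u c →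
      (∃ l e, u :: c :: r = l ++ [e, x] ∧ ArrowInto G e x) →
      (∀ a b d, [a, b, d] <:+: u :: c :: r → ArrowInto G a b ∧ ArrowInto G d b) →
      VisibleEdge G x y := by
  obtain ⟨⟨h1, h2, h3, h4, h5⟩, hSZ, hyZ, ho⟩ := mconn_iff.1 hp
  have hyne : y ≠ x := h.ne.symm
  induction L using List.reverseRecOn with
  | nil => ?_
  | append_singleton L t ih => ?_
  all_goals
    intro u c r e hpar hlast huc hend ht
    have hxmem : x ∈ c :: r := List.mem_of_getLast? hlast
    have hnod : (u :: c :: r).Nodup := h2.sublist (by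
      rw [e]
      exact (List.IsInfix.sublist ⟨_, _, rfl⟩))
    have hux : u ≠ x := by
      rintro rfl
      exact (List.nodup_cons.1 hnod).1 hxmem
    have huy : u ≠ y := by
      rintro rfl
      rw [e] at h2
      exact (List.nodup_append.1 h2).2.2 u (by simp) u (by simp) rfl
    have hchain : (u :: c :: r).IsChain G.adj := h1.infix (by
      rw [e]
      exact ⟨_, _, rfl⟩)
    by_cases hadj : ¬ G.adj u y
    · refine ⟨hxy, u, huy, hadj, Or.inr ⟨u :: c :: r, collPath_iff.2 ⟨⟨hchain, hnod, rfl, ?_, by simp⟩, ht⟩, hend, ?_⟩⟩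
      · rw [List.getLast?_cons_cons]; exact hlast
      · intro w hw
        obtain ⟨a, b, hi⟩ := isInter_iff.1 hw
        rcases List.infix_cons_iff.1 hi with ⟨t', ht'⟩ | hi
        · simp at ht'
          exact hpar w (by simp [ht'.2.1])
        · exact hpar w (hi.subset (by simp))
    push Not at hadj
  · exfalso
    rw [e] at h3
    simp at h3
    subst h3
    refine hsep [u, y] (mconn_iff.2 ⟨⟨(openW_pair (Z := ∅) hadj).1, by simp [huy], rfl, rfl, by simp⟩,
      ?_, ?_, openW_pair hadj⟩)
    · rintro (h' | h')
      · exact hSZ h'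
      · exact hSx h'
    · rintro (h' | h')
      · exact hyZ h'
      · exact hyne h'
  · have huc' : G.adj u c := (List.isChain_cons_cons.1 hchain).1
    have htuc : [t, u, c] <:+: p := infix3_iff.2 ⟨L, r ++ [y], by simp [e]⟩
    have hact := ho.2 t u c htuc
    have hpre : L ++ [t] ++ [u] <+: p := ⟨c :: r ++ [y], by simp [e]⟩
    have hxpre : x ∉ L ++ [t] ++ [u] := by
      intro hm
      rw [e] at h2
      have : (L ++ [t] ++ [u] ++ (c :: r ++ [y])).Nodup := by simpa using h2
      exact (List.nodup_append.1 this).2.2 x hm x (List.mem_append_left _ hxmem) rfl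
    have hypre : y ∉ L ++ [t] ++ [u] := by
      intro hm
      rw [e] at h2
      have : (L ++ [t] ++ [u] ++ (c :: r ++ [y])).Nodup := by simpa using h2
      exact (List.nodup_append.1 this).2.2 y hm y (by simp) rfl
    have key : ¬ Act G Z t u y := by
      intro hact'
      have hchain' : (L ++ [t] ++ [u] ++ [y]).IsChain G.adj :=
        List.isChain_append.2 ⟨h1.prefix hpre, by simp, by simpa using hadj⟩
      refine hsep (L ++ [t] ++ [u] ++ [y]) (mconn_iff.2 ⟨⟨hchain', ?_, ?_, by simp, by simp⟩,
        ?_, ?_, hchain', ?_⟩)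
      · refine List.nodup_append.2 ⟨h2.sublist hpre.sublist, by simp, ?_⟩
        rintro a ha b hb rfl
        simp at hb
        exact hypre (hb ▸ ha)
      · rw [e] at h3
        cases L <;> simpa using h3
      · rintro (h' | h')
        · exact hSZ h'
        · exact hSx h'
      · rintro (h' | h')
        · exact hyZ h'
        · exact hyne h'
      · intro a b d hi
        have : Act G Z a b d ∧ b ∈ L ++ [t] ++ [u] := by
          rw [List.append_assoc] at hi
          rcases infix3_split (l₂ := [y]) hi with hi | hi | ⟨rfl, ⟨l', e1⟩, ⟨l'', e2⟩⟩
          · exact ⟨ho.2 a b d (hi.trans hpre.isInfix), hi.subset (by simp)⟩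
          · have := hi.length_le
            simp at this
          · simp at e2
            have e1' := (List.append_inj' e1 rfl).2
            simp at e1'
            rw [← e1', ← e2.1]
            exact ⟨hact', by simp⟩
        obtain ⟨⟨A1, A2⟩, A3⟩ := this
        refine ⟨fun hc => ?_, fun hc => ?_⟩
        · obtain ⟨z, hz, hz'⟩ := A1 hc
          exact ⟨z, Or.inl hz, hz'⟩
        · rintro (h' | h')
          · exact A2 hc h'
          · exact hxpre (h' ▸ A3)
    have htu : ArrowInto G t u := by
      by_contra hn
      exact key ⟨fun h' => absurd h'.1 hn, fun _ => hact.2 (fun h' => hn h'.1)⟩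
    by_cases hcu : ArrowInto G c u
    · have hyu : ¬ ArrowInto G y u := fun hyu =>
        key ⟨fun _ => hact.1 ⟨htu, hcu⟩, fun h' => absurd ⟨htu, hyu⟩ h'⟩
      have hd : G.dir u y := (not_arrow_iff (adj_symm hadj)).1 hyu
      refine ih t u (c :: r) (by simp [e]) ?_ ?_ htu ?_ ?_
      · intro w hw
        rcases List.mem_cons.1 hw with rfl | hw
        · exact hd
        · exact hpar w hw
      · rw [List.getLast?_cons_cons]; exact hlast
      · obtain ⟨l, e', h', h''⟩ := hend
        exact ⟨t :: l, e', by rw [h']; rfl, h''⟩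
      · intro a b d hi
        rcases List.infix_cons_iff.1 hi with ⟨t', ht'⟩ | hi
        · simp at ht'
          obtain ⟨rfl, rfl, rfl, -⟩ := ht'
          exact ⟨htu, hcu⟩
        · exact ht a b d hi
    · exfalso
      have hd : G.dir u c := (not_arrow_iff (adj_symm huc')).1 hcu
      have hanc : Ancestor G u y := Ancestor.head hd (Ancestor.head (hpar c (by simp)) (Ancestor.refl _))
      by_cases hyu : ArrowInto G y u
      · rcases hyu with h' | h'
        · exact h.not_dir_y h'
        · exact h.mag.2.1 u y (G.bidir_symm _ _ h') hanc
      · exact key ⟨fun h' => absurd h'.2 hyu, fun _ => hact.2 (fun h' => hcu h'.2)⟩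

lemma r1_imp {G : MixedGraph V} {x y S : V} {O Z : Set V} (h : Pretreatment G x y O)
    (hSx : S ≠ x) (hc : MConn G Z S y) (hsep : MSep G (Z ∪ {x}) S y) : VisibleEdge G x y := by
  obtain ⟨p, hp⟩ := hc
  obtain ⟨⟨h1, h2, h3, h4, h5⟩, hSZ, hyZ, ho⟩ := mconn_iff.1 hp
  have hcon := hsep p
  obtain ⟨u, v, hi, hnc⟩ : ∃ u v, [u, x, v] <:+: p ∧ ¬ (ArrowInto G u x ∧ ArrowInto G v x) := by
    by_contra hno
    push Not at hno
    refine hcon (mconn_iff.2 ⟨⟨h1, h2, h3, h4, h5⟩, ?_, ?_, h1, ?_⟩)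
    · rintro (h' | h')
      · exact hSZ h'
      · exact hSx h'
    · rintro (h' | h')
      · exact hyZ h'
      · exact h.ne h'.symm
    · intro a b d hi
      refine ⟨fun hc => ?_, fun hc => ?_⟩
      · obtain ⟨z, hz, hz'⟩ := (ho.2 a b d hi).1 hc
        exact ⟨z, Or.inl hz, hz'⟩
      · rintro (h' | h')
        · exact (ho.2 a b d hi).2 hc h'
        · have hbx : b = x := h'
          subst hbx
          exact hc ⟨(hno a d hi).1, (hno a d hi).2⟩
  obtain ⟨l₁, l₂, e⟩ := infix3_iff.1 hi
  obtain ⟨l, el⟩ := List.getLast?_eq_some_iff.1 h4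
  have hchain : [u, x, v].IsChain G.adj := h1.infix hi
  have hux : G.adj u x := (List.isChain_cons_cons.1 hchain).1
  have hxv : G.adj x v := (List.isChain_cons_cons.1 (List.isChain_cons_cons.1 hchain).2).1
  have huy : u ≠ y := by
    rintro rfl
    rw [e] at h4 h2
    have h4' : (x :: v :: l₂).getLast? = some u := by
      simpa [List.getLast?_append, List.getLast?_cons] using h4
    exact (List.nodup_cons.1 (List.nodup_append.1 h2).2.1).1 (List.mem_of_getLast? h4')
  have hu : ArrowInto G u x := by
    by_contra hn
    exact huy (h.dir_x ((not_arrow_iff hux).1 hn))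
  have hv : G.dir x v := (not_arrow_iff (adj_symm hxv)).1 (fun h' => hnc ⟨hu, h'⟩)
  obtain rfl := h.dir_x hv
  have hl2 : l₂ = [] := by
    cases l₂ with
    | nil => rfl
    | cons d l₂ =>
      exfalso
      rw [e] at h4 h2
      have h4' : (d :: l₂).getLast? = some v := by
        simpa [List.getLast?_append, List.getLast?_cons] using h4
      have h2' := (List.nodup_append.1 h2).2.1
      simp only [List.nodup_cons] at h2'
      exact h2'.2.2.1 (List.mem_of_getLast? h4')
  subst hl2
  refine r1_aux h hv hSx hp hsep l₁ u x [] (by simp [e]) (by simpa using hv) rfl hu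
    ⟨[], u, rfl, hu⟩ ?_
  intro a b d hi
  have := hi.length_le
  simp at this

/-- Soundness and completeness of rule R1 (combining Theorems 2, 4 and 5). -/
theorem rule_R1_sound_and_complete
    {V : Type*} [Fintype V] (G : MixedGraph V) (x y : V) (O : Set V)
    (h : Pretreatment G x y O) :
    (∃ S ∈ MarkovBlanket G x \ {y}, ∃ Z ⊆ MarkovBlanket G y \ {x},
        MConn G Z S y ∧ MSep G (Z ∪ {x}) S y) ↔
      (VisibleEdge G x y ∧ ∃ Z ⊆ O, ValidAdjustment G x y Z) := by
  constructor
  · rintro ⟨S, hS, Z, -, hc, hsep⟩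
    have hv := r1_imp h hS.1.1 hc hsep
    exact ⟨hv, exists_valid h hv⟩
  · rintro ⟨hv, -⟩
    exact visible_imp h hv

end CausalGraph
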